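/- Uniform convergence generalization bound for learning conditional distributions: Suppose every θ ∈ Θ satisfies the support-margin assumption with constant β, and suppose Θ admits a partition into C_ε(Θ) pieces Θ₁, …, Θ_{C_ε(Θ)} such that within each piece the values of both L̂_PL and L̃_PL vary by at most ε/2 (for any two parameters θ₁, θ₂ in the same piece, |L̃_PL(θ₁) − L̃_PL(θ₂)| ≤ ε/2 and |L̂_PL(θ₁) − L̂_PL(θ₂)| ≤ ε/2). Then for every δ ∈ (0,1), with probability at least 1 − δ over n i.i.d. sequences and m i.i.d. masks per sequence, simultaneously for all θ ∈ Θ: |L̂_PL(θ) − L̃_PL(θ)| < ( sqrt( 2^{3N−1} |Ω|^N C_ε(Θ) / (m δ) ) + sqrt( ln(4 C_ε(Θ)/δ) / (2n) ) ) · ln(1/β) + ε. -/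

import Mathlib

open scoped Classical BigOperators

noncomputable section

/-- The conditional distribution of a (nonnegative) function `r` on `Ω^N`, conditioned on
agreeing with `x` outside the mask `K`: the distribution on completions `y`. -/
def condAt {Ω : Type*} [Fintype Ω] {N : ℕ} (r : (Fin N → Ω) → ℝ)
    (x : Fin N → Ω) (K : Finset (Fin N)) (y : Fin N → Ω) : ℝ :=
  (if ∀ i ∉ K, y i = x i then r y else 0)
    / ∑ z : Fin N → Ω, (if ∀ i ∉ K, z i = x i then r z else 0)

/-- KL divergence between the conditionals (given mask `K` and context `x_{-K}`)
of two distributions `r` and `q` on `Ω^N`. -/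
def klCond {Ω : Type*} [Fintype Ω] {N : ℕ} (r q : (Fin N → Ω) → ℝ)
    (x : Fin N → Ω) (K : Finset (Fin N)) : ℝ :=
  ∑ y : Fin N → Ω, condAt r x K y * Real.log (condAt r x K y / condAt q x K y)

theorem aux_mgf {A : Type*} [Fintype A] (w : A → ℝ) (w0 : ∀ a, 0 ≤ w a) (w1 : ∑ a, w a = 1)
    (f : A → ℝ) (B : ℝ) (f0 : ∀ a, 0 ≤ f a) (fB : ∀ a, f a ≤ B) (s : ℝ) :
    ∑ a, w a * Real.exp (s * (f a - ∑ b, w b * f b)) ≤ Real.exp (s ^ 2 * B ^ 2 / 8) := by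
  let _ : MeasurableSpace A := ⊤
  have hw : ∑ a, ENNReal.ofReal (w a) = 1 := by
    rw [← ENNReal.ofReal_sum_of_nonneg (fun a _ => w0 a), w1, ENNReal.ofReal_one]
  let p : PMF A := PMF.ofFintype (fun a => ENNReal.ofReal (w a)) hw
  have hp : ∀ a, (p a).toReal = w a := fun a => by
    simp [p, PMF.ofFintype_apply, ENNReal.toReal_ofReal (w0 a)]
  have h := (ProbabilityTheory.hasSubgaussianMGF_of_mem_Icc (μ := p.toMeasure) (X := f)
    (a := 0) (b := B) (measurable_from_top.aemeasurable)
    (Filter.Eventually.of_forall fun a => ⟨f0 a, fB a⟩)).mgf_le s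
  rw [ProbabilityTheory.mgf, PMF.integral_eq_sum, PMF.integral_eq_sum] at h
  simp only [hp, smul_eq_mul] at h
  refine h.trans (le_of_eq ?_)
  congr 1
  simp only [sub_zero, NNReal.coe_pow, NNReal.coe_div, coe_nnnorm, Real.norm_eq_abs, div_pow, sq_abs, NNReal.coe_ofNat]
  ring

theorem aux_tail {A : Type*} [Fintype A] (w : A → ℝ) (w0 : ∀ a, 0 ≤ w a) (w1 : ∑ a, w a = 1)
    (f : A → ℝ) (B : ℝ) (hB : 0 < B) (f0 : ∀ a, 0 ≤ f a) (fB : ∀ a, f a ≤ B)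
    (n : ℕ) (hn : 0 < n) (t : ℝ) (ht : 0 ≤ t) (σ : ℝ) (hσ : σ ^ 2 = 1) :
    ∑ Z : Fin n → A, (∏ i, w (Z i)) *
      (if t ≤ σ * ∑ i, (f (Z i) - ∑ b, w b * f b) then (1 : ℝ) else 0)
      ≤ Real.exp (-(2 * t ^ 2 / (n * B ^ 2))) := by
  have hn' : (0 : ℝ) < n := by exact_mod_cast hn
  set s : ℝ := 4 * t / (n * B ^ 2) with hs
  have hs0 : 0 ≤ s := by positivity
  set μ := ∑ b, w b * f b with hμ
  calc _ ≤ ∑ Z : Fin n → A, Real.exp (-(s * t)) *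
        ∏ i, (w (Z i) * Real.exp ((s * σ) * (f (Z i) - μ))) := by
        apply Finset.sum_le_sum
        intro Z _
        rw [Finset.prod_mul_distrib, mul_left_comm, ← Real.exp_sum, ← Finset.mul_sum,
          ← Real.exp_add]
        apply mul_le_mul_of_nonneg_left _ (Finset.prod_nonneg fun i _ => w0 _)
        split_ifs with h
        · apply Real.one_le_exp
          have := mul_le_mul_of_nonneg_left h hs0
          linarith
        · positivity
    _ = Real.exp (-(s * t)) * (∑ a, w a * Real.exp ((s * σ) * (f a - μ))) ^ n := by
        rw [← Finset.mul_sum, Fintype.sum_pow]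
    _ ≤ Real.exp (-(s * t)) * (Real.exp ((s * σ) ^ 2 * B ^ 2 / 8)) ^ n := by
        gcongr
        · exact Finset.sum_nonneg fun a _ => mul_nonneg (w0 a) (Real.exp_pos _).le
        · exact aux_mgf w w0 w1 f B f0 fB _
    _ = _ := by
        rw [← Real.exp_nat_mul, ← Real.exp_add, mul_pow, hσ]
        congr 1
        rw [hs]
        field_simp
        ring

theorem aux_condAt_nonneg {Ω : Type*} [Fintype Ω] {N : ℕ} (r : (Fin N → Ω) → ℝ)
    (hr : ∀ x, 0 ≤ r x) (x : Fin N → Ω) (K : Finset (Fin N)) (y : Fin N → Ω) :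
    0 ≤ condAt r x K y := by
  unfold condAt
  apply div_nonneg
  · split_ifs <;> simp [hr]
  · apply Finset.sum_nonneg
    intro z _
    split_ifs <;> simp [hr]

theorem aux_condAt_sum {Ω : Type*} [Fintype Ω] {N : ℕ} (r : (Fin N → Ω) → ℝ)
    (x : Fin N → Ω) (K : Finset (Fin N)) :
    (∀ y, condAt r x K y = 0) ∨ ∑ y, condAt r x K y = 1 := by
  unfold condAt
  by_cases h : ∑ z : Fin N → Ω, (if ∀ i ∉ K, z i = x i then r z else 0) = 0
  · left; intro y; rw [h, div_zero]
  · right; rw [← Finset.sum_div, div_self h]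

theorem aux_kl {Ω : Type*} [Fintype Ω] {N : ℕ} (r q : (Fin N → Ω) → ℝ)
    (hr : ∀ x, 0 ≤ r x) (hq : ∀ x, 0 ≤ q x) (β : ℝ) (hβ0 : 0 < β) (hβ1 : β ≤ 1)
    (x : Fin N → Ω) (K : Finset (Fin N))
    (hm : ∀ y : Fin N → Ω, (∀ i ∉ K, y i = x i) → β ≤ condAt q x K y) :
    0 ≤ klCond r q x K ∧ klCond r q x K ≤ Real.log (1 / β) := by
  have hp0 := aux_condAt_nonneg r hr x K
  have hq0 := aux_condAt_nonneg q hq x K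
  have hB : 0 ≤ Real.log (1 / β) := Real.log_nonneg ((one_le_div hβ0).2 hβ1)
  have hq1 : ∑ y, condAt q x K y = 1 := by
    rcases aux_condAt_sum q x K with h | h
    · have := hm x (fun _ _ => rfl)
      rw [h] at this; linarith
    · exact h
  have hsupp : ∀ y, 0 < condAt r x K y → β ≤ condAt q x K y := by
    intro y hy
    apply hm
    by_contra hc
    simp [condAt, hc] at hy
  unfold klCond
  rcases aux_condAt_sum r x K with h | h
  · simp only [h, zero_mul, Finset.sum_const_zero]; exact ⟨le_rfl, hB⟩
  constructor
  · have : ∑ y, (condAt r x K y - condAt q x K y) ≤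
        ∑ y, condAt r x K y * Real.log (condAt r x K y / condAt q x K y) := by
      apply Finset.sum_le_sum
      intro y _
      rcases (hp0 y).eq_or_lt with h0 | h0
      · rw [← h0]; simp [hq0 y]
      · have hqy : 0 < condAt q x K y := lt_of_lt_of_le hβ0 (hsupp y h0)
        have := Real.one_sub_inv_le_log_of_pos (div_pos h0 hqy)
        have := mul_le_mul_of_nonneg_left this h0.le
        refine le_trans (le_of_eq ?_) this
        field_simp
    rw [Finset.sum_sub_distrib, h, hq1] at this
    linarith
  · calc _ ≤ ∑ y, condAt r x K y * Real.log (1 / β) := by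
          apply Finset.sum_le_sum
          intro y _
          rcases (hp0 y).eq_or_lt with h0 | h0
          · rw [← h0]; simp
          · have hqy : 0 < condAt q x K y := lt_of_lt_of_le hβ0 (hsupp y h0)
            apply mul_le_mul_of_nonneg_left _ h0.le
            apply Real.log_le_log (div_pos h0 hqy)
            have h1 : condAt r x K y ≤ 1 := by
              rw [← h]
              exact Finset.single_le_sum (fun z _ => hp0 z) (Finset.mem_univ y)
            exact div_le_div₀ zero_le_one h1 hβ0 (hsupp y h0)
      _ = _ := by rw [← Finset.sum_mul, h, one_mul]


/-- **Uniform convergence generalization bound for learning conditional distributions.**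
Suppose every parameter `θ` of the family `q : P → (Ω^N → ℝ)` satisfies the support-margin
assumption with constant `β`, and that the parameter space `P` admits a partition into
`C` pieces within each of which both the empirical loss `L̂_PL` (for every realization of
the data) and the population loss `L̃_PL` vary by at most `ε/2`.  Then for every
`δ ∈ (0,1)`, with probability at least `1 - δ` over `n` i.i.d. sequences and `m` i.i.d.
masks per sequence, simultaneously for all `θ`:
`|L̂_PL(θ) - L̃_PL(θ)| < (sqrt(2^{3N-1}|Ω|^N C/(mδ)) + sqrt(ln(4C/δ)/(2n))) ln(1/β) + ε`. -/
theorem uniform_generalization_bound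
    {Ω : Type*} [Fintype Ω] {N n m : ℕ} (hn : 0 < n) (hm : 0 < m)
    {P : Type*}
    (pX : (Fin N → Ω) → ℝ) (hpX0 : ∀ x, 0 ≤ pX x) (hpX1 : ∑ x, pX x = 1)
    (pK : (Fin N → Ω) → Finset (Fin N) → ℝ) (hpK0 : ∀ x K, 0 ≤ pK x K)
    (hpK1 : ∀ x, ∑ K : Finset (Fin N), pK x K = 1)
    -- the fixed reference distribution p̃ on Ω^N (whose conditionals are the targets)
    (pt : (Fin N → Ω) → ℝ) (hpt0 : ∀ x, 0 ≤ pt x) (hpt1 : ∑ x, pt x = 1)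
    -- the parametric family θ ↦ p_θ, with support margin β on all conditionals
    (q : P → (Fin N → Ω) → ℝ) (hq0 : ∀ θ x, 0 ≤ q θ x)
    (β : ℝ) (hβ0 : 0 < β) (hβ1 : β ≤ 1)
    (hmargin : ∀ (θ : P) (x : Fin N → Ω) (K : Finset (Fin N)) (y : Fin N → Ω),
      (∀ i ∉ K, y i = x i) → β ≤ condAt (q θ) x K y)
    -- the empirical and population pseudolikelihood losses
    (Lhat : (Fin n → (Fin N → Ω)) → (Fin n → Fin m → Finset (Fin N)) → P → ℝ)
    (hLhat : ∀ X M θ, Lhat X M θ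
      = ((1 : ℝ) / n) * ∑ i, ((1 : ℝ) / m) * ∑ j, klCond pt (q θ) (X i) (M i j))
    (Ltilde : P → ℝ)
    (hLtilde : ∀ θ, Ltilde θ
      = ∑ x, pX x * ∑ K : Finset (Fin N), pK x K * klCond pt (q θ) x K)
    -- complexity assumption: a partition of P into C pieces with oscillation ≤ ε/2
    (ε : ℝ) (hε : 0 < ε)
    (C : ℕ) (hC : 0 < C) (parts : Fin C → Set P)
    (hcover : ∀ θ : P, ∃ a, θ ∈ parts a)
    (hoscTilde : ∀ (a : Fin C), ∀ θ₁ ∈ parts a, ∀ θ₂ ∈ parts a,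
      |Ltilde θ₁ - Ltilde θ₂| ≤ ε / 2)
    (hoscHat : ∀ X M (a : Fin C), ∀ θ₁ ∈ parts a, ∀ θ₂ ∈ parts a,
      |Lhat X M θ₁ - Lhat X M θ₂| ≤ ε / 2)
    (δ : ℝ) (hδ0 : 0 < δ) (hδ1 : δ < 1) :
    1 - δ ≤
      ∑ X : Fin n → (Fin N → Ω), ∑ M : Fin n → Fin m → Finset (Fin N),
        ((∏ i, pX (X i)) * ∏ i, ∏ j, pK (X i) (M i j)) *
          (if ∀ θ : P,
              |Lhat X M θ - Ltilde θ|
                < (Real.sqrt ((2 : ℝ) ^ (3 * N) / 2 * (Fintype.card Ω : ℝ) ^ N * C / (m * δ))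
                    + Real.sqrt (Real.log (4 * C / δ) / (2 * n))) * Real.log (1 / β) + ε
           then 1 else 0) := by
  have hn' : (0 : ℝ) < n := by exact_mod_cast hn
  have hm' : (0 : ℝ) < m := by exact_mod_cast hm
  have hC' : (1 : ℝ) ≤ C := by exact_mod_cast hC
  set B := Real.log (1 / β) with hBdef
  have hB : 0 ≤ B := Real.log_nonneg ((one_le_div hβ0).2 hβ1)
  have hkl : ∀ θ x K, 0 ≤ klCond pt (q θ) x K ∧ klCond pt (q θ) x K ≤ B := fun θ x K =>
    aux_kl pt (q θ) hpt0 (hq0 θ) β hβ0 hβ1 x K (hmargin θ x K)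
  set s1 := Real.sqrt ((2 : ℝ) ^ (3 * N) / 2 * (Fintype.card Ω : ℝ) ^ N * C / (m * δ))
  set s2 := Real.sqrt (Real.log (4 * C / δ) / (2 * n)) with hs2
  have hs1 : 0 ≤ s1 := Real.sqrt_nonneg _
  have hs20 : 0 ≤ s2 := Real.sqrt_nonneg _
  have h4 : 1 ≤ 4 * C / δ := by rw [one_le_div hδ0]; linarith
  have hs2sq : 2 * n * s2 ^ 2 = Real.log (4 * C / δ) := by
    rw [hs2, Real.sq_sqrt (div_nonneg (Real.log_nonneg h4) (by positivity))]
    field_simp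
  -- single-sample space
  let A := (Fin N → Ω) × (Fin m → Finset (Fin N))
  let w : A → ℝ := fun a => pX a.1 * ∏ j, pK a.1 (a.2 j)
  let F : P → A → ℝ := fun θ a => ((1 : ℝ) / m) * ∑ j, klCond pt (q θ) a.1 (a.2 j)
  have w0 : ∀ a, 0 ≤ w a := fun a =>
    mul_nonneg (hpX0 _) (Finset.prod_nonneg fun j _ => hpK0 _ _)
  have hKsum : ∀ x, ∑ M : Fin m → Finset (Fin N), ∏ j, pK x (M j) = 1 := fun x => by
    rw [← Fintype.sum_pow, hpK1, one_pow]
  have w1 : ∑ a, w a = 1 := by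
    rw [Fintype.sum_prod_type]
    simp only [w, ← Finset.mul_sum, hKsum, mul_one, hpX1]
  have hF0 : ∀ θ a, 0 ≤ F θ a := fun θ a =>
    mul_nonneg (by positivity) (Finset.sum_nonneg fun j _ => (hkl θ _ _).1)
  have hFB : ∀ θ a, F θ a ≤ B := fun θ a => by
    have : ∑ j, klCond pt (q θ) a.1 (a.2 j) ≤ ∑ j : Fin m, B :=
      Finset.sum_le_sum fun j _ => (hkl θ _ _).2
    simp only [Finset.sum_const, Finset.card_univ, Fintype.card_fin, nsmul_eq_mul] at this
    simp only [F]
    rw [one_div, inv_mul_le_iff₀ hm']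
    exact this
  -- marginal of one mask
  have hmarg : ∀ (x : Fin N → Ω) (g : Finset (Fin N) → ℝ) (j : Fin m),
      ∑ M : Fin m → Finset (Fin N), (∏ k, pK x (M k)) * g (M j) = ∑ K, pK x K * g K := by
    intro x g j
    have h1 : ∀ M : Fin m → Finset (Fin N), (∏ k, pK x (M k)) * g (M j)
        = ∏ k, (pK x (M k) * if k = j then g (M k) else 1) := by
      intro M
      rw [Finset.prod_mul_distrib]
      simp
    simp only [h1]
    rw [← Fintype.prod_sum (fun k K => pK x K * if k = j then g K else 1)]
    rw [Finset.prod_eq_single j]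
    · simp
    · intro k _ hk
      simp [hk, hpK1]
    · simp
  have hmean : ∀ θ, ∑ a, w a * F θ a = Ltilde θ := by
    intro θ
    rw [hLtilde, Fintype.sum_prod_type]
    apply Finset.sum_congr rfl
    intro x _
    simp only [w, F]
    have : ∀ M : Fin m → Finset (Fin N), pX x * (∏ j, pK x (M j)) *
        ((1 : ℝ) / m * ∑ j, klCond pt (q θ) x (M j)) =
        pX x * ((1 : ℝ) / m) * ∑ j, (∏ k, pK x (M k)) * klCond pt (q θ) x (M j) := by
      intro M
      rw [← Finset.mul_sum]; ring
    simp only [this]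
    rw [← Finset.mul_sum, Finset.sum_comm]
    simp only [hmarg x (fun K => klCond pt (q θ) x K)]
    simp only [Finset.sum_const, Finset.card_univ, Fintype.card_fin, nsmul_eq_mul]
    field_simp
  -- rewrite as a sum over i.i.d. samples
  set W : (Fin n → A) → ℝ := fun Z => ∏ i, w (Z i) with hW
  have hW0 : ∀ Z, 0 ≤ W Z := fun Z => Finset.prod_nonneg fun i _ => w0 _
  have hW1 : ∑ Z, W Z = 1 := by
    rw [hW, ← Fintype.sum_pow, w1, one_pow]
  have hre : ∀ G : (Fin n → (Fin N → Ω)) → (Fin n → Fin m → Finset (Fin N)) → ℝ,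
      ∑ X : Fin n → (Fin N → Ω), ∑ M : Fin n → Fin m → Finset (Fin N),
        ((∏ i, pX (X i)) * ∏ i, ∏ j, pK (X i) (M i j)) * G X M
      = ∑ Z : Fin n → A, W Z * G (fun i => (Z i).1) (fun i => (Z i).2) := by
    intro G
    rw [← Fintype.sum_prod_type']
    refine (Fintype.sum_equiv (Equiv.arrowProdEquivProdArrow (Fin n)
      (fun _ => Fin N → Ω) (fun _ => Fin m → Finset (Fin N))) _ _ ?_).symm
    intro Z
    simp [hW, w, Equiv.arrowProdEquivProdArrow, Finset.prod_mul_distrib]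
  rw [hre (fun X M => if ∀ θ : P, |Lhat X M θ - Ltilde θ| < (s1 + s2) * B + ε then 1 else 0)]
  have hdiff : ∀ (Z : Fin n → A) θ, n * (Lhat (fun i => (Z i).1) (fun i => (Z i).2) θ - Ltilde θ)
      = ∑ i, (F θ (Z i) - ∑ b, w b * F θ b) := by
    intro Z θ
    rw [hmean, hLhat, Finset.sum_sub_distrib]
    simp only [Finset.sum_const, Finset.card_univ, Fintype.card_fin, nsmul_eq_mul, F]
    field_simp
  rcases hB.eq_or_lt with hB0 | hBpos
  · -- degenerate case
    have hz : ∀ θ x K, klCond pt (q θ) x K = 0 := fun θ x K =>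
      le_antisymm ((hkl θ x K).2.trans hB0.symm.le) (hkl θ x K).1
    have : ∀ Z : Fin n → A, (if ∀ θ : P, |Lhat (fun i => (Z i).1) (fun i => (Z i).2) θ - Ltilde θ|
        < (s1 + s2) * B + ε then (1 : ℝ) else 0) = 1 := by
      intro Z
      rw [if_pos]
      intro θ
      rw [hLhat, hLtilde, ← hB0]
      simp [hz, hε]
    simp only [this, mul_one, hW1]
    linarith
  rcases isEmpty_or_nonempty P with hP | hP
  · simp [hW1, hδ0.le]
  let rep : Fin C → P := fun a => if h : (parts a).Nonempty then h.some else Classical.arbitrary P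
  have hrep : ∀ a θ, θ ∈ parts a → rep a ∈ parts a := by
    intro a θ h
    have h' : (parts a).Nonempty := ⟨θ, h⟩
    simp only [rep, dif_pos h']
    exact h'.some_mem
  set t := n * (s2 * B) with ht
  have ht0 : 0 ≤ t := by positivity
  let I : ℝ → Fin C → (Fin n → A) → ℝ := fun σ a Z =>
    if t ≤ σ * ∑ i, (F (rep a) (Z i) - ∑ b, w b * F (rep a) b) then 1 else 0
  have hI0 : ∀ σ a Z, 0 ≤ I σ a Z := by
    intro σ a Z; simp only [I]; split_ifs <;> norm_num
  have hexp : Real.exp (-(2 * t ^ 2 / (n * B ^ 2))) = δ / (4 * C) := by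
    have : 2 * t ^ 2 / (n * B ^ 2) = Real.log (4 * C / δ) := by
      rw [← hs2sq, ht]; field_simp
    rw [this, Real.exp_neg, Real.exp_log (by linarith), inv_div]
  have htail : ∀ σ : ℝ, σ ^ 2 = 1 → ∀ a, ∑ Z, W Z * I σ a Z ≤ δ / (4 * C) := by
    intro σ hσ a
    rw [← hexp]
    exact aux_tail w w0 w1 (F (rep a)) B hBpos (hF0 _) (hFB _) n hn t ht0 σ hσ
  have hkey : ∀ Z : Fin n → A, 1 - ∑ a, (I 1 a Z + I (-1) a Z) ≤
      (if ∀ θ : P, |Lhat (fun i => (Z i).1) (fun i => (Z i).2) θ - Ltilde θ|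
        < (s1 + s2) * B + ε then (1 : ℝ) else 0) := by
    intro Z
    split_ifs with hgood
    · have : 0 ≤ ∑ a, (I 1 a Z + I (-1) a Z) :=
        Finset.sum_nonneg fun a _ => add_nonneg (hI0 _ _ _) (hI0 _ _ _)
      linarith
    · push Not at hgood
      obtain ⟨θ, hθ⟩ := hgood
      obtain ⟨a, ha⟩ := hcover θ
      have h1 := hoscTilde a θ ha _ (hrep a θ ha)
      have h2 := hoscHat (fun i => (Z i).1) (fun i => (Z i).2) a θ ha _ (hrep a θ ha)
      have h3 : 1 ≤ I 1 a Z + I (-1) a Z := by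
        have hs1B : 0 ≤ s1 * B := mul_nonneg hs1 hB
        have hbig : s2 * B ≤ |Lhat (fun i => (Z i).1) (fun i => (Z i).2) (rep a) - Ltilde (rep a)| := by
          rw [add_mul] at hθ
          rw [abs_le] at h1 h2
          rcases abs_cases (Lhat (fun i => (Z i).1) (fun i => (Z i).2) θ - Ltilde θ) with h | h
          · refine le_trans ?_ (le_abs_self _)
            linarith [h.1, h1.1, h1.2, h2.1, h2.2]
          · refine le_trans ?_ (neg_le_abs _)
            linarith [h.1, h1.1, h1.2, h2.1, h2.2]
        rcases le_abs.1 hbig with h | h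
        · have : I 1 a Z = 1 := by
            simp only [I]
            rw [if_pos]
            rw [← hdiff, one_mul, ht]
            exact mul_le_mul_of_nonneg_left h hn'.le
          linarith [hI0 (-1) a Z]
        · have : I (-1) a Z = 1 := by
            simp only [I]
            rw [if_pos]
            rw [← hdiff, ht]
            have := mul_le_mul_of_nonneg_left h hn'.le
            linarith
          linarith [hI0 1 a Z]
      have h4 := Finset.single_le_sum (f := fun a => I 1 a Z + I (-1) a Z)
        (fun b _ => add_nonneg (hI0 _ _ _) (hI0 _ _ _)) (Finset.mem_univ a)
      linarith
  calc 1 - δ ≤ 1 - ∑ a : Fin C, (δ / (4 * C) + δ / (4 * C)) := by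
        simp only [Finset.sum_const, Finset.card_univ, Fintype.card_fin, nsmul_eq_mul]
        have : (C : ℝ) * (δ / (4 * C) + δ / (4 * C)) = δ / 2 := by field_simp; norm_num
        linarith
    _ ≤ 1 - ∑ a, (∑ Z, W Z * I 1 a Z + ∑ Z, W Z * I (-1) a Z) := by
        apply sub_le_sub_left
        apply Finset.sum_le_sum
        intro a _
        exact add_le_add (htail 1 (by norm_num) a) (htail (-1) (by norm_num) a)
    _ = ∑ Z, W Z * (1 - ∑ a, (I 1 a Z + I (-1) a Z)) := by
        simp only [mul_sub, mul_one, Finset.sum_sub_distrib, hW1, Finset.mul_sum]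
        rw [Finset.sum_comm]
        simp only [mul_add, Finset.sum_add_distrib]
    _ ≤ _ := Finset.sum_le_sum fun Z _ => mul_le_mul_of_nonneg_left (hkey Z) (hW0 Z)
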